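/- Let X be a simplicial complex on [n] and 𝐜 = 𝐚 − 𝐛 with 𝐚 ∈ ℕ^{n+1} of support a ⊆ [n] and 𝐛 ∈ {0,1}^{n+1} the characteristic vector of b ⊆ [n], where a ∩ b = ∅. Then Hom(I_X, A_X)_𝐜 is isomorphic as a ℂ-vector space to H^0 of the kernel cochain complex ker(C^•(N_{a−b}) → C^•(Ñ_{a−b})) of the restriction map between the simplicial cochain complexes of the order complexes of N_{a−b} and Ñ_{a−b}. -/

import Mathlib

open MvPolynomial

/-- A simplicial complex on `[n] = {0,…,n}`. -/
def IsSimplicialComplex {n : ℕ} (S : Set (Finset (Fin (n+1)))) : Prop :=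
  ∅ ∈ S ∧ ∀ f ∈ S, ∀ g ⊆ f, g ∈ S

/-- The squarefree monomial `x^p = ∏_{i ∈ p} x_i`. -/
noncomputable def xmon {n : ℕ} (p : Finset (Fin (n+1))) : MvPolynomial (Fin (n+1)) ℂ :=
  ∏ i ∈ p, X i

/-- The monomial `x^e` for an exponent vector `e ∈ ℕ^{n+1}`. -/
noncomputable def emon {n : ℕ} (e : Fin (n+1) → ℕ) : MvPolynomial (Fin (n+1)) ℂ :=
  monomial (Finsupp.equivFunOnFinite.symm e) 1

/-- The Stanley–Reisner ideal `I_X = (x^p : p ∉ X)`. -/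
noncomputable def SRideal {n : ℕ} (S : Set (Finset (Fin (n+1)))) : Ideal (MvPolynomial (Fin (n+1)) ℂ) :=
  Ideal.span {q | ∃ p : Finset (Fin (n+1)), p ∉ S ∧ q = xmon p}

lemma xmon_mem_SRideal {n : ℕ} (S : Set (Finset (Fin (n+1))))
    {p : Finset (Fin (n+1))} (hp : p ∉ S) : xmon p ∈ SRideal S :=
  Ideal.subset_span ⟨p, hp, rfl⟩

/-- The characteristic vector of `p ⊆ [n]`. -/
def charVec {n : ℕ} (p : Finset (Fin (n+1))) : Fin (n+1) → ℕ :=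
  fun i => if i ∈ p then 1 else 0

/-- The degree `𝐜 = 𝐚 − 𝐛 ∈ ℤ^{n+1}` where `𝐛` is the characteristic vector of `b`. -/
def degC {n : ℕ} (A : Fin (n+1) → ℕ) (b : Finset (Fin (n+1))) : Fin (n+1) → ℤ :=
  fun i => (A i : ℤ) - (charVec b i : ℤ)

/-- The shifted exponent `𝐩 + 𝐜` (as a vector of naturals, when nonnegative). -/
def shiftExp {n : ℕ} (p : Finset (Fin (n+1))) (c : Fin (n+1) → ℤ) : Fin (n+1) → ℕ :=
  fun i => ((charVec p i : ℤ) + c i).toNat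

/-- A `P`-module homomorphism `φ : I_X → A_X` is homogeneous of degree `𝐜`:
for every non-face `p`, `φ(x^p)` is a scalar multiple of `π(x^{𝐩+𝐜})` when
`𝐩 + 𝐜 ∈ ℕ^{n+1}`, and `φ(x^p) = 0` otherwise. -/
def IsHomOfDeg {n : ℕ} (S : Set (Finset (Fin (n+1))))
    (φ : SRideal S →ₗ[MvPolynomial (Fin (n+1)) ℂ] (MvPolynomial (Fin (n+1)) ℂ ⧸ SRideal S))
    (c : Fin (n+1) → ℤ) : Prop :=
  ∀ (p : Finset (Fin (n+1))) (hp : p ∉ S),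
    ((∀ i, 0 ≤ (charVec p i : ℤ) + c i) →
      ∃ μ : ℂ, φ ⟨xmon p, xmon_mem_SRideal S hp⟩ =
        Ideal.Quotient.mk (SRideal S) (C μ * emon (shiftExp p c))) ∧
    (¬ (∀ i, 0 ≤ (charVec p i : ℤ) + c i) →
      φ ⟨xmon p, xmon_mem_SRideal S hp⟩ = 0)

/-- The support of a vector `𝐚 ∈ ℕ^{n+1}`. -/
def suppV {n : ℕ} (A : Fin (n+1) → ℕ) : Finset (Fin (n+1)) :=
  Finset.univ.filter (fun i => A i ≠ 0)

/-- `N_{a−b} = {f ∈ X : a ⊆ f, f ∩ b = ∅, f ∪ b ∉ X}`. -/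
def Nab {n : ℕ} (S : Set (Finset (Fin (n+1)))) (a b : Finset (Fin (n+1))) :
    Set (Finset (Fin (n+1))) :=
  {f | f ∈ S ∧ a ⊆ f ∧ f ∩ b = ∅ ∧ f ∪ b ∉ S}

/-- `Ñ_{a−b} = {f ∈ N_{a−b} : f ∪ b′ ∉ X for some proper subset b′ ⊊ b}`. -/
def Ntilde {n : ℕ} (S : Set (Finset (Fin (n+1)))) (a b : Finset (Fin (n+1))) :
    Set (Finset (Fin (n+1))) :=
  {f | f ∈ Nab S a b ∧ ∃ b' ⊂ b, f ∪ b' ∉ S}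

section StanleyReisner

variable {n : ℕ}

lemma emon_mul (d e : Fin (n+1) → ℕ) : emon d * emon e = emon (d + e) := by
  have h : Finsupp.equivFunOnFinite.symm d + Finsupp.equivFunOnFinite.symm e =
      Finsupp.equivFunOnFinite.symm (d + e) := by
    ext i
    simp
  rw [emon, emon, monomial_mul, one_mul, h, emon]

lemma xmon_eq_emon (p : Finset (Fin (n+1))) : xmon p = emon (charVec p) := by
  have h : Finsupp.equivFunOnFinite.symm (charVec p) = ∑ i ∈ p, Finsupp.single i 1 := by
    ext j
    simp [charVec, Finsupp.finsetSum_apply, Finsupp.single_apply]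
  rw [emon, h, monomial_sum_one]
  rfl

lemma SRideal_eq_span_monomial (S : Set (Finset (Fin (n+1)))) :
    SRideal S = Ideal.span ((fun s => monomial s (1 : ℂ)) ''
      {s | ∃ p, p ∉ S ∧ s = Finsupp.equivFunOnFinite.symm (charVec p)}) := by
  unfold SRideal
  congr 1
  ext q
  constructor
  · rintro ⟨p, hp, rfl⟩
    exact ⟨_, ⟨p, hp, rfl⟩, (xmon_eq_emon p).symm⟩
  · rintro ⟨_, ⟨p, hp, rfl⟩, rfl⟩
    exact ⟨p, hp, (xmon_eq_emon p).symm⟩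

lemma mem_suppV {e : Fin (n+1) → ℕ} {i : Fin (n+1)} : i ∈ suppV e ↔ e i ≠ 0 := by
  simp [suppV]

lemma charVec_le_iff {p : Finset (Fin (n+1))} {e : Fin (n+1) → ℕ} :
    charVec p ≤ e ↔ p ⊆ suppV e := by
  constructor
  · intro h i hi
    have := h i
    simp only [charVec, hi, if_true] at this
    rw [mem_suppV]
    omega
  · intro h i
    by_cases hi : i ∈ p
    · have := mem_suppV.1 (h hi)
      simp only [charVec, hi, if_true]
      omega
    · simp [charVec, hi]

lemma suppV_charVec (p : Finset (Fin (n+1))) : suppV (charVec p) = p := by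
  ext i
  simp [mem_suppV, charVec]

lemma suppV_add (d e : Fin (n+1) → ℕ) : suppV (d + e) = suppV d ∪ suppV e := by
  ext i
  simp only [Finset.mem_union, mem_suppV, Pi.add_apply]
  omega

/-- A monomial whose support is not a face vanishes in the Stanley–Reisner ring. -/
lemma mk_C_mul_emon_eq_zero {S : Set (Finset (Fin (n+1)))} {e : Fin (n+1) → ℕ} {μ : ℂ}
    (he : suppV e ∉ S) : Ideal.Quotient.mk (SRideal S) (C μ * emon e) = 0 := by
  rw [Ideal.Quotient.eq_zero_iff_mem]
  apply Ideal.mul_mem_left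
  have h : emon e = emon (e - charVec (suppV e)) * xmon (suppV e) := by
    rw [xmon_eq_emon, emon_mul, tsub_add_cancel_of_le (charVec_le_iff.2 subset_rfl)]
  rw [h]
  exact Ideal.mul_mem_left _ _ (xmon_mem_SRideal S he)

/-- A monomial whose support is a face is nonzero in the Stanley–Reisner ring. -/
lemma eq_of_mk_C_mul_emon_eq {S : Set (Finset (Fin (n+1)))} (hS : IsSimplicialComplex S)
    {e : Fin (n+1) → ℕ} (he : suppV e ∈ S) {μ ν : ℂ}
    (h : Ideal.Quotient.mk (SRideal S) (C μ * emon e) =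
      Ideal.Quotient.mk (SRideal S) (C ν * emon e)) : μ = ν := by
  by_contra hne
  rw [Ideal.Quotient.eq, ← sub_mul, ← C_sub, emon, C_mul_monomial, mul_one,
    SRideal_eq_span_monomial, mem_ideal_span_monomial_image] at h
  obtain ⟨_, ⟨p, hp, rfl⟩, hle⟩ := h (Finsupp.equivFunOnFinite.symm e) (by
    rw [mem_support_iff, coeff_monomial, if_pos rfl]
    exact sub_ne_zero.2 hne)
  exact hp (hS.2 _ he _ (charVec_le_iff.1 fun i => hle i))

lemma degC_nonneg_iff {A : Fin (n+1) → ℕ} {b p : Finset (Fin (n+1))}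
    (hdisj : ∀ i ∈ b, A i = 0) :
    (∀ i, 0 ≤ (charVec p i : ℤ) + degC A b i) ↔ b ⊆ p := by
  constructor
  · intro h i hi
    by_contra hp
    have := h i
    simp [charVec, degC, hi, hp, hdisj i hi] at this
  · intro h i
    by_cases hi : i ∈ b
    · simp [charVec, degC, hi, h hi]
    · simp only [charVec, degC, hi, if_false]
      omega

lemma shiftExp_degC {A : Fin (n+1) → ℕ} {b p : Finset (Fin (n+1))} (hb : b ⊆ p) :
    shiftExp p (degC A b) = charVec (p \ b) + A := by
  ext i
  by_cases hi : i ∈ b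
  · have := hb hi
    simp [shiftExp, charVec, degC, hi, this]
  · by_cases hp : i ∈ p <;> simp [shiftExp, charVec, degC, hi, hp]; omega

variable {S : Set (Finset (Fin (n+1)))}

lemma smul_quotient_eq_mk_mul (r : MvPolynomial (Fin (n+1)) ℂ)
    (y : MvPolynomial (Fin (n+1)) ℂ ⧸ SRideal S) :
    r • y = Ideal.Quotient.mk (SRideal S) r * y := by
  obtain ⟨y, rfl⟩ := Ideal.Quotient.mk_surjective y
  rfl

lemma map_xmon_of_subset
    (φ : SRideal S →ₗ[MvPolynomial (Fin (n+1)) ℂ] (MvPolynomial (Fin (n+1)) ℂ ⧸ SRideal S))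
    {p q : Finset (Fin (n+1))} (hp : p ∉ S) (hq : q ∉ S) (hpq : p ⊆ q) :
    φ ⟨xmon q, xmon_mem_SRideal S hq⟩ =
      Ideal.Quotient.mk (SRideal S) (emon (charVec (q \ p))) *
        φ ⟨xmon p, xmon_mem_SRideal S hp⟩ := by
  have h : (⟨xmon q, xmon_mem_SRideal S hq⟩ : SRideal S) =
      emon (charVec (q \ p)) • ⟨xmon p, xmon_mem_SRideal S hp⟩ := by
    apply Subtype.ext
    simp only [SetLike.val_smul, smul_eq_mul, xmon_eq_emon, emon_mul]
    congr 1
    ext i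
    by_cases h1 : i ∈ p
    · simp [charVec, h1, hpq h1]
    · simp [charVec, h1]
  rw [h, map_smul, smul_quotient_eq_mk_mul]

/-- The scalar by which `φ` acts on `x^p` also describes its action on multiples of `x^p`. -/
lemma map_xmon_eq_of_subset
    {φ : SRideal S →ₗ[MvPolynomial (Fin (n+1)) ℂ] (MvPolynomial (Fin (n+1)) ℂ ⧸ SRideal S)}
    {A : Fin (n+1) → ℕ} {b p q : Finset (Fin (n+1))} (hp : p ∉ S) (hq : q ∉ S) (hpq : p ⊆ q)
    (hb : b ⊆ p) {μ : ℂ}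
    (h : φ ⟨xmon p, xmon_mem_SRideal S hp⟩ =
      Ideal.Quotient.mk (SRideal S) (C μ * emon (charVec (p \ b) + A))) :
    φ ⟨xmon q, xmon_mem_SRideal S hq⟩ =
      Ideal.Quotient.mk (SRideal S) (C μ * emon (charVec (q \ b) + A)) := by
  rw [map_xmon_of_subset φ hp hq hpq, h, ← map_mul, mul_left_comm, emon_mul]
  congr 3
  ext i
  by_cases h1 : i ∈ b
  · simp [charVec, h1, hb h1]
  · by_cases h2 : i ∈ p
    · simp [charVec, h1, h2, hpq h2]
    · simp [charVec, h1, h2]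

lemma linearMap_SRideal_ext
    {φ ψ : SRideal S →ₗ[MvPolynomial (Fin (n+1)) ℂ] (MvPolynomial (Fin (n+1)) ℂ ⧸ SRideal S)}
    (h : ∀ p (hp : p ∉ S), φ ⟨xmon p, xmon_mem_SRideal S hp⟩ =
      ψ ⟨xmon p, xmon_mem_SRideal S hp⟩) : φ = ψ := by
  ext ⟨x, hx⟩
  unfold SRideal at hx
  induction hx using Submodule.span_induction with
  | mem x hx =>
    obtain ⟨p, hp, rfl⟩ := hx
    exact h p hp
  | zero => exact (map_zero φ).trans (map_zero ψ).symm
  | add x y hx hy ihx ihy =>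
    have h' := congrArg₂ (· + ·) ihx ihy
    simp only [← map_add] at h'
    exact h'
  | smul r x hx ih =>
    have h' := congrArg (r • ·) ih
    simp only [← map_smul] at h'
    exact h'

/-- A function on `N_{a−b}` encodes the homogeneous map `φ` if its value at `f` is the scalar
by which `φ` acts on `x^{f ∪ b}`. -/
def Encodes (A : Fin (n+1) → ℕ) (b : Finset (Fin (n+1)))
    (φ : SRideal S →ₗ[MvPolynomial (Fin (n+1)) ℂ] (MvPolynomial (Fin (n+1)) ℂ ⧸ SRideal S))
    (lam : {f : Finset (Fin (n+1)) // f ∈ Nab S (suppV A) b} → ℂ) : Prop :=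
  ∀ f, φ ⟨xmon (f.1 ∪ b), xmon_mem_SRideal S f.2.2.2.2⟩ =
    Ideal.Quotient.mk (SRideal S) (C (lam f) * emon (charVec f.1 + A))

lemma suppV_charVec_add_of_mem_Nab {A : Fin (n+1) → ℕ} {b f : Finset (Fin (n+1))}
    (hf : f ∈ Nab S (suppV A) b) : suppV (charVec f + A) = f := by
  rw [suppV_add, suppV_charVec, Finset.union_eq_left.2 hf.2.1]

lemma union_sdiff_of_mem_Nab {a b f : Finset (Fin (n+1))}
    (hf : f ∈ Nab S a b) : (f ∪ b) \ b = f := by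
  rw [Finset.union_sdiff_right, Finset.sdiff_eq_self_iff_disjoint,
    Finset.disjoint_iff_inter_eq_empty]
  exact hf.2.2.1

lemma sdiff_union_mem_Nab (hS : IsSimplicialComplex S) {A : Fin (n+1) → ℕ}
    {b p : Finset (Fin (n+1))} (hdisj : ∀ i ∈ b, A i = 0) (hp : p ∉ S)
    (hf : p \ b ∪ suppV A ∈ S) : p \ b ∪ suppV A ∈ Nab S (suppV A) b := by
  refine ⟨hf, Finset.subset_union_right, ?_, fun h => hp (hS.2 _ h _ ?_)⟩
  · ext i
    simp only [Finset.mem_inter, Finset.mem_union, Finset.mem_sdiff, mem_suppV,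
      Finset.notMem_empty, iff_false]
    rintro ⟨h | h, hb⟩
    · exact h.2 hb
    · exact h (hdisj i hb)
  · intro i hi
    simp only [Finset.mem_union, Finset.mem_sdiff]
    tauto

lemma exists_encodes {A : Fin (n+1) → ℕ} {b : Finset (Fin (n+1))} (hdisj : ∀ i ∈ b, A i = 0)
    {φ : SRideal S →ₗ[MvPolynomial (Fin (n+1)) ℂ] (MvPolynomial (Fin (n+1)) ℂ ⧸ SRideal S)}
    (hφ : IsHomOfDeg S φ (degC A b)) : ∃ lam, Encodes A b φ lam := by
  have h : ∀ f : {f : Finset (Fin (n+1)) // f ∈ Nab S (suppV A) b}, ∃ μ : ℂ,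
      φ ⟨xmon (f.1 ∪ b), xmon_mem_SRideal S f.2.2.2.2⟩ =
        Ideal.Quotient.mk (SRideal S) (C μ * emon (charVec f.1 + A)) := by
    intro f
    have hb : b ⊆ f.1 ∪ b := Finset.subset_union_right
    obtain ⟨μ, hμ⟩ := (hφ (f.1 ∪ b) f.2.2.2.2).1 ((degC_nonneg_iff hdisj).2 hb)
    rw [shiftExp_degC hb, union_sdiff_of_mem_Nab f.2] at hμ
    exact ⟨μ, hμ⟩
  choose lam hlam using h
  exact ⟨lam, hlam⟩

lemma Encodes.unique (hS : IsSimplicialComplex S) {A : Fin (n+1) → ℕ}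
    {b : Finset (Fin (n+1))}
    {φ : SRideal S →ₗ[MvPolynomial (Fin (n+1)) ℂ] (MvPolynomial (Fin (n+1)) ℂ ⧸ SRideal S)}
    {lam lam' : {f : Finset (Fin (n+1)) // f ∈ Nab S (suppV A) b} → ℂ}
    (h : Encodes A b φ lam) (h' : Encodes A b φ lam') : lam = lam' := by
  ext f
  refine eq_of_mk_C_mul_emon_eq hS (e := charVec f.1 + A) ?_ ((h f).symm.trans (h' f))
  rw [suppV_charVec_add_of_mem_Nab f.2]
  exact f.2.1

lemma Encodes.eq_zero_of_mem_Ntilde (hS : IsSimplicialComplex S) {A : Fin (n+1) → ℕ}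
    {b : Finset (Fin (n+1))} (hdisj : ∀ i ∈ b, A i = 0)
    {φ : SRideal S →ₗ[MvPolynomial (Fin (n+1)) ℂ] (MvPolynomial (Fin (n+1)) ℂ ⧸ SRideal S)}
    (hφ : IsHomOfDeg S φ (degC A b))
    {lam : {f : Finset (Fin (n+1)) // f ∈ Nab S (suppV A) b} → ℂ}
    (h : Encodes A b φ lam) (f : {f : Finset (Fin (n+1)) // f ∈ Nab S (suppV A) b})
    (hf : f.1 ∈ Ntilde S (suppV A) b) : lam f = 0 := by
  obtain ⟨-, b', hb', hfb'⟩ := hf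
  have hnot : ¬ b ⊆ f.1 ∪ b' := by
    intro hsub
    refine hb'.2 fun i hi => (Finset.mem_union.1 (hsub hi)).resolve_left fun hif => ?_
    have : i ∈ f.1 ∩ b := Finset.mem_inter.2 ⟨hif, hi⟩
    simp [f.2.2.2.1] at this
  have h0 := (hφ _ hfb').2 (mt (degC_nonneg_iff hdisj).1 hnot)
  have h1 := map_xmon_of_subset φ hfb' f.2.2.2.2
    (Finset.union_subset_union_right hb'.1)
  rw [h0, mul_zero, h f] at h1
  refine eq_of_mk_C_mul_emon_eq hS (e := charVec f.1 + A) ?_ (h1.trans (by simp))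
  rw [suppV_charVec_add_of_mem_Nab f.2]
  exact f.2.1

lemma Encodes.eq_of_subset (hS : IsSimplicialComplex S) {A : Fin (n+1) → ℕ}
    {b : Finset (Fin (n+1))}
    {φ : SRideal S →ₗ[MvPolynomial (Fin (n+1)) ℂ] (MvPolynomial (Fin (n+1)) ℂ ⧸ SRideal S)}
    {lam : {f : Finset (Fin (n+1)) // f ∈ Nab S (suppV A) b} → ℂ}
    (h : Encodes A b φ lam) {f g : {f : Finset (Fin (n+1)) // f ∈ Nab S (suppV A) b}}
    (hfg : f.1 ⊆ g.1) : lam f = lam g := by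
  have h1 := map_xmon_eq_of_subset (A := A) (b := b) (μ := lam f) f.2.2.2.2 g.2.2.2.2
    (Finset.union_subset_union_left hfg) Finset.subset_union_right
    (by rw [union_sdiff_of_mem_Nab f.2]; exact h f)
  rw [union_sdiff_of_mem_Nab g.2, h g] at h1
  refine (eq_of_mk_C_mul_emon_eq hS (e := charVec g.1 + A) ?_ h1).symm
  rw [suppV_charVec_add_of_mem_Nab g.2]
  exact g.2.1

/-- A homogeneous map is determined by any function encoding it. -/
lemma Encodes.injective (hS : IsSimplicialComplex S) {A : Fin (n+1) → ℕ}
    {b : Finset (Fin (n+1))} (hdisj : ∀ i ∈ b, A i = 0)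
    {φ ψ : SRideal S →ₗ[MvPolynomial (Fin (n+1)) ℂ] (MvPolynomial (Fin (n+1)) ℂ ⧸ SRideal S)}
    (hφ : IsHomOfDeg S φ (degC A b)) (hψ : IsHomOfDeg S ψ (degC A b))
    {lam : {f : Finset (Fin (n+1)) // f ∈ Nab S (suppV A) b} → ℂ}
    (h : Encodes A b φ lam) (h' : Encodes A b ψ lam) : φ = ψ := by
  refine linearMap_SRideal_ext fun p hp => ?_
  by_cases hb : b ⊆ p
  · obtain ⟨μ, hμ⟩ := (hφ p hp).1 ((degC_nonneg_iff hdisj).2 hb)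
    obtain ⟨ν, hν⟩ := (hψ p hp).1 ((degC_nonneg_iff hdisj).2 hb)
    rw [shiftExp_degC hb] at hμ hν
    by_cases hf : p \ b ∪ suppV A ∈ S
    · have hN := sdiff_union_mem_Nab hS hdisj hp hf
      have hsub : p ⊆ (p \ b ∪ suppV A) ∪ b := by
        intro i hi
        simp only [Finset.mem_union, Finset.mem_sdiff]
        tauto
      have hsupp : suppV (charVec (p \ b ∪ suppV A) + A) ∈ S := by
        rwa [suppV_charVec_add_of_mem_Nab hN]
      have h1 := map_xmon_eq_of_subset hp hN.2.2.2 hsub hb hμ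
      have h2 := map_xmon_eq_of_subset hp hN.2.2.2 hsub hb hν
      rw [union_sdiff_of_mem_Nab hN] at h1 h2
      have e1 := eq_of_mk_C_mul_emon_eq hS hsupp (h1.symm.trans (h ⟨_, hN⟩))
      have e2 := eq_of_mk_C_mul_emon_eq hS hsupp (h2.symm.trans (h' ⟨_, hN⟩))
      rw [hμ, hν, e1, e2]
    · rw [← suppV_charVec (p \ b), ← suppV_add] at hf
      rw [hμ, hν, mk_C_mul_emon_eq_zero hf, mk_C_mul_emon_eq_zero hf]
  · rw [(hφ p hp).2 (mt (degC_nonneg_iff hdisj).1 hb),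
      (hψ p hp).2 (mt (degC_nonneg_iff hdisj).1 hb)]

open Classical in
/-- Extension by zero of a function on `N_{a−b}`. -/
noncomputable def extendByZero {N : Set (Finset (Fin (n+1)))} (lam : {f // f ∈ N} → ℂ)
    (f : Finset (Fin (n+1))) : ℂ :=
  if hf : f ∈ N then lam ⟨f, hf⟩ else 0

/-- The value at `x^m` of the homogeneous map of degree `𝐚 − 𝐛` with prescribed scalars. -/
noncomputable def shiftValue (A : Fin (n+1) → ℕ) (b : Finset (Fin (n+1)))
    (lam : {f : Finset (Fin (n+1)) // f ∈ Nab S (suppV A) b} → ℂ) (m : Fin (n+1) → ℕ) :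
    MvPolynomial (Fin (n+1)) ℂ ⧸ SRideal S :=
  if b ⊆ suppV m then
    Ideal.Quotient.mk (SRideal S)
      (C (extendByZero lam (suppV m \ b ∪ suppV A)) * emon (m - charVec b + A))
  else 0

/-- The `ℂ`-linear extension of `shiftValue` to all polynomials. -/
noncomputable def shiftMap (A : Fin (n+1) → ℕ) (b : Finset (Fin (n+1)))
    (lam : {f : Finset (Fin (n+1)) // f ∈ Nab S (suppV A) b} → ℂ) :
    MvPolynomial (Fin (n+1)) ℂ →ₗ[ℂ] MvPolynomial (Fin (n+1)) ℂ ⧸ SRideal S :=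
  (basisMonomials (Fin (n+1)) ℂ).constr ℂ fun m => shiftValue A b lam m

lemma shiftMap_emon (A : Fin (n+1) → ℕ) (b : Finset (Fin (n+1)))
    (lam : {f : Finset (Fin (n+1)) // f ∈ Nab S (suppV A) b} → ℂ) (m : Fin (n+1) → ℕ) :
    shiftMap A b lam (emon m) = shiftValue A b lam m := by
  have := (basisMonomials (Fin (n+1)) ℂ).constr_basis ℂ (fun m => shiftValue A b lam m)
    (Finsupp.equivFunOnFinite.symm m)
  rwa [coe_basisMonomials] at this

lemma shiftValue_add_charVec (hS : IsSimplicialComplex S) {A : Fin (n+1) → ℕ}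
    {b : Finset (Fin (n+1))} (hdisj : ∀ i ∈ b, A i = 0)
    {lam : {f : Finset (Fin (n+1)) // f ∈ Nab S (suppV A) b} → ℂ}
    (h0 : ∀ f, f.1 ∈ Ntilde S (suppV A) b → lam f = 0)
    (h1 : ∀ f g, f.1 ≠ g.1 → (f.1 ⊆ g.1 ∨ g.1 ⊆ f.1) → lam f = lam g)
    (m : Fin (n+1) → ℕ) {p : Finset (Fin (n+1))} (hp : p ∉ S) :
    shiftValue A b lam (m + charVec p) =
      Ideal.Quotient.mk (SRideal S) (emon m) * shiftValue A b lam (charVec p) := by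
  have hq : suppV (m + charVec p) = suppV m ∪ p := by rw [suppV_add, suppV_charVec]
  have hqS : suppV m ∪ p ∉ S := fun h => hp (hS.2 _ h _ Finset.subset_union_right)
  unfold shiftValue
  rw [hq, suppV_charVec]
  by_cases hb : b ⊆ p
  · have hexp : m + charVec p - charVec b + A = m + (charVec p - charVec b + A) := by
      rw [add_tsub_assoc_of_le (charVec_le_iff.2 (by rwa [suppV_charVec])), add_assoc]
    rw [if_pos hb, if_pos (hb.trans Finset.subset_union_right), ← map_mul, mul_left_comm,
      emon_mul, hexp]
    by_cases hf : suppV (m + (charVec p - charVec b + A)) ∈ S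
    · have hsub : (suppV m ∪ p) \ b ∪ suppV A ⊆ suppV (m + (charVec p - charVec b + A)) := by
        intro i
        simp only [Finset.mem_union, Finset.mem_sdiff, mem_suppV, Pi.add_apply, Pi.sub_apply,
          charVec]
        by_cases hip : i ∈ p <;> by_cases hib : i ∈ b <;> simp [hip, hib] <;> omega
      have hle : p \ b ∪ suppV A ⊆ (suppV m ∪ p) \ b ∪ suppV A :=
        Finset.union_subset_union_left
          (Finset.sdiff_subset_sdiff Finset.subset_union_right subset_rfl)
      have hg := hS.2 _ hf _ hsub
      have hgN := sdiff_union_mem_Nab hS hdisj hqS hg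
      have hfN := sdiff_union_mem_Nab hS hdisj hp (hS.2 _ hg _ hle)
      congr 3
      rw [extendByZero, extendByZero, dif_pos hgN, dif_pos hfN]
      by_cases heq : (suppV m ∪ p) \ b ∪ suppV A = p \ b ∪ suppV A
      · congr 1
        exact Subtype.ext heq
      · exact h1 _ _ heq (Or.inr hle)
    · rw [mk_C_mul_emon_eq_zero hf, mk_C_mul_emon_eq_zero hf]
  · rw [if_neg hb, mul_zero]
    split_ifs with hbq
    · suffices extendByZero lam ((suppV m ∪ p) \ b ∪ suppV A) = 0 by simp [this]
      unfold extendByZero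
      split_ifs with hN
      · refine h0 _ ⟨hN, b ∩ p, ⟨Finset.inter_subset_left, fun h => hb fun i hi =>
          (Finset.mem_inter.1 (h hi)).2⟩, fun h => hp (hS.2 _ h _ fun i hi => ?_)⟩
        simp only [Finset.mem_union, Finset.mem_sdiff, Finset.mem_inter]
        tauto
      · rfl
    · rfl

lemma shiftMap_mul (hS : IsSimplicialComplex S) {A : Fin (n+1) → ℕ}
    {b : Finset (Fin (n+1))} (hdisj : ∀ i ∈ b, A i = 0)
    {lam : {f : Finset (Fin (n+1)) // f ∈ Nab S (suppV A) b} → ℂ}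
    (h0 : ∀ f, f.1 ∈ Ntilde S (suppV A) b → lam f = 0)
    (h1 : ∀ f g, f.1 ≠ g.1 → (f.1 ⊆ g.1 ∨ g.1 ⊆ f.1) → lam f = lam g)
    {x : MvPolynomial (Fin (n+1)) ℂ} (hx : x ∈ SRideal S) (r : MvPolynomial (Fin (n+1)) ℂ) :
    shiftMap A b lam (r * x) = Ideal.Quotient.mk (SRideal S) r * shiftMap A b lam x := by
  unfold SRideal at hx
  induction hx using Submodule.span_induction generalizing r with
  | mem x hx =>
    obtain ⟨p, hp, rfl⟩ := hx
    induction r using MvPolynomial.induction_on' with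
    | monomial u a =>
      have hu : monomial u a = a • emon u := by
        rw [emon, smul_monomial, smul_eq_mul, mul_one, Finsupp.equivFunOnFinite_symm_coe]
      have hmk : Ideal.Quotient.mk (SRideal S) (a • emon u) =
          a • Ideal.Quotient.mk (SRideal S) (emon u) := rfl
      rw [hu, hmk, smul_mul_assoc, smul_mul_assoc, map_smul, xmon_eq_emon, emon_mul,
        shiftMap_emon, shiftMap_emon, shiftValue_add_charVec hS hdisj h0 h1 _ hp]
    | add u v hu hv => rw [add_mul, map_add, map_add, add_mul, hu, hv]
  | zero => simp
  | add x y hx hy ihx ihy => rw [mul_add, map_add, map_add, mul_add, ihx, ihy]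
  | smul s x hx ih => rw [smul_eq_mul, ← mul_assoc, ih, ih, map_mul, mul_assoc]

/-- The homogeneous `P`-linear map with prescribed scalars. -/
noncomputable def shiftHom (hS : IsSimplicialComplex S) {A : Fin (n+1) → ℕ}
    {b : Finset (Fin (n+1))} (hdisj : ∀ i ∈ b, A i = 0)
    {lam : {f : Finset (Fin (n+1)) // f ∈ Nab S (suppV A) b} → ℂ}
    (h0 : ∀ f, f.1 ∈ Ntilde S (suppV A) b → lam f = 0)
    (h1 : ∀ f g, f.1 ≠ g.1 → (f.1 ⊆ g.1 ∨ g.1 ⊆ f.1) → lam f = lam g) :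
    SRideal S →ₗ[MvPolynomial (Fin (n+1)) ℂ] (MvPolynomial (Fin (n+1)) ℂ ⧸ SRideal S) where
  toFun x := shiftMap A b lam x.1
  map_add' x y := map_add _ _ _
  map_smul' r x := by
    rw [RingHom.id_apply, smul_quotient_eq_mk_mul]
    exact shiftMap_mul hS hdisj h0 h1 x.2 r

lemma shiftHom_xmon (hS : IsSimplicialComplex S) {A : Fin (n+1) → ℕ}
    {b : Finset (Fin (n+1))} (hdisj : ∀ i ∈ b, A i = 0)
    {lam : {f : Finset (Fin (n+1)) // f ∈ Nab S (suppV A) b} → ℂ}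
    (h0 : ∀ f, f.1 ∈ Ntilde S (suppV A) b → lam f = 0)
    (h1 : ∀ f g, f.1 ≠ g.1 → (f.1 ⊆ g.1 ∨ g.1 ⊆ f.1) → lam f = lam g)
    {p : Finset (Fin (n+1))} (hp : p ∉ S) :
    shiftHom hS hdisj h0 h1 ⟨xmon p, xmon_mem_SRideal S hp⟩ =
      if b ⊆ p then Ideal.Quotient.mk (SRideal S)
        (C (extendByZero lam (p \ b ∪ suppV A)) * emon (charVec (p \ b) + A)) else 0 := by
  have h : shiftHom hS hdisj h0 h1 ⟨xmon p, xmon_mem_SRideal S hp⟩ =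
      shiftMap A b lam (xmon p) := rfl
  rw [h, xmon_eq_emon, shiftMap_emon, shiftValue, suppV_charVec]
  have he : charVec p - charVec b = charVec (p \ b) := by
    ext i
    by_cases hip : i ∈ p <;> by_cases hib : i ∈ b <;> simp [charVec, hip, hib]
  rw [he]

lemma isHomOfDeg_shiftHom (hS : IsSimplicialComplex S) {A : Fin (n+1) → ℕ}
    {b : Finset (Fin (n+1))} (hdisj : ∀ i ∈ b, A i = 0)
    {lam : {f : Finset (Fin (n+1)) // f ∈ Nab S (suppV A) b} → ℂ}
    (h0 : ∀ f, f.1 ∈ Ntilde S (suppV A) b → lam f = 0)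
    (h1 : ∀ f g, f.1 ≠ g.1 → (f.1 ⊆ g.1 ∨ g.1 ⊆ f.1) → lam f = lam g) :
    IsHomOfDeg S (shiftHom hS hdisj h0 h1) (degC A b) := by
  intro p hp
  rw [degC_nonneg_iff hdisj, shiftHom_xmon hS hdisj h0 h1 hp]
  constructor
  · intro hb
    rw [if_pos hb, shiftExp_degC hb]
    exact ⟨_, rfl⟩
  · intro hb
    rw [if_neg hb]

lemma encodes_shiftHom (hS : IsSimplicialComplex S) {A : Fin (n+1) → ℕ}
    {b : Finset (Fin (n+1))} (hdisj : ∀ i ∈ b, A i = 0)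
    {lam : {f : Finset (Fin (n+1)) // f ∈ Nab S (suppV A) b} → ℂ}
    (h0 : ∀ f, f.1 ∈ Ntilde S (suppV A) b → lam f = 0)
    (h1 : ∀ f g, f.1 ≠ g.1 → (f.1 ⊆ g.1 ∨ g.1 ⊆ f.1) → lam f = lam g) :
    Encodes A b (shiftHom hS hdisj h0 h1) lam := by
  intro f
  rw [shiftHom_xmon hS hdisj h0 h1 f.2.2.2.2, if_pos Finset.subset_union_right, union_sdiff_of_mem_Nab f.2,
    Finset.union_eq_left.2 f.2.2.1, extendByZero, dif_pos f.2]

end StanleyReisner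

/-- `Hom(I_X, A_X)_𝐜` is ℂ-linearly isomorphic to `H⁰` of the kernel
cochain complex `ker(C^•(N_{a−b}) → C^•(Ñ_{a−b}))`.  Unfolding the definition of the
order complex, `H⁰` of this kernel complex is the space of functions
`λ : N_{a−b} → ℂ` vanishing on `Ñ_{a−b}` (degree-0 kernel condition) whose
differential vanishes, i.e. `λ(f) = λ(g)` for every flag `f ⊊ g` (equivalently, for
all distinct comparable `f, g ∈ N_{a−b}`).  The claimed isomorphism is a bijection
which is additive and ℂ-homogeneous. -/
theorem hom_piece_iso_H0_kernel_complex {n : ℕ} (S : Set (Finset (Fin (n+1))))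
    (hS : IsSimplicialComplex S) (A : Fin (n+1) → ℕ) (b : Finset (Fin (n+1)))
    (hdisj : ∀ i ∈ b, A i = 0) :
    ∃ E : {φ : SRideal S →ₗ[MvPolynomial (Fin (n+1)) ℂ]
            (MvPolynomial (Fin (n+1)) ℂ ⧸ SRideal S) // IsHomOfDeg S φ (degC A b)} ≃
          {lam : {f : Finset (Fin (n+1)) // f ∈ Nab S (suppV A) b} → ℂ //
            (∀ f, f.1 ∈ Ntilde S (suppV A) b → lam f = 0) ∧
            ∀ f g, f.1 ≠ g.1 → (f.1 ⊆ g.1 ∨ g.1 ⊆ f.1) → lam f = lam g},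
      (∀ φ ψ ω, ω.1 = φ.1 + ψ.1 → ∀ f, (E ω).1 f = (E φ).1 f + (E ψ).1 f) ∧
      (∀ (μ₀ : ℂ) φ ψ, ψ.1 = (C μ₀ : MvPolynomial (Fin (n+1)) ℂ) • φ.1 →
        ∀ f, (E ψ).1 f = μ₀ * (E φ).1 f) := by
  choose lam hlam using fun φ : {φ : SRideal S →ₗ[MvPolynomial (Fin (n+1)) ℂ]
    (MvPolynomial (Fin (n+1)) ℂ ⧸ SRideal S) // IsHomOfDeg S φ (degC A b)} =>
      exists_encodes hdisj φ.2
  refine ⟨Equiv.ofBijective (fun φ => ⟨lam φ, fun f hf =>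
    (hlam φ).eq_zero_of_mem_Ntilde hS hdisj φ.2 f hf, fun f g _ hfg => hfg.elim
      (fun h => (hlam φ).eq_of_subset hS h) fun h => ((hlam φ).eq_of_subset hS h).symm⟩)
    ⟨fun φ ψ h => ?_, fun l => ?_⟩, fun φ ψ ω h f => ?_, fun μ₀ φ ψ h f => ?_⟩
  · have h' : lam φ = lam ψ := congrArg Subtype.val h
    exact Subtype.ext ((hlam φ).injective hS hdisj φ.2 ψ.2 (h' ▸ hlam ψ))
  · refine ⟨⟨shiftHom hS hdisj l.2.1 l.2.2, isHomOfDeg_shiftHom hS hdisj l.2.1 l.2.2⟩, ?_⟩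
    exact Subtype.ext ((hlam _).unique hS (encodes_shiftHom hS hdisj l.2.1 l.2.2))
  · refine congrFun ((hlam ω).unique hS (lam' := fun f => lam φ f + lam ψ f) fun f => ?_) f
    rw [h, LinearMap.add_apply, hlam φ f, hlam ψ f, ← map_add, ← add_mul, ← C_add]
  · refine congrFun ((hlam ψ).unique hS (lam' := fun f => μ₀ * lam φ f) fun f => ?_) f
    rw [h, LinearMap.smul_apply, hlam φ f, C_mul, mul_assoc, map_mul _ (C μ₀),
      smul_quotient_eq_mk_mul]
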